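/- Let S be a board. Let F be the number of cells of S, V_I the number of interior vertices of S, and V_B the number of boundary vertices of S. Then 2·F = 2·V_I + V_B − 2. -/

import Mathlib

open scoped Matrix

/-- A cell of the integer grid, representing the closed unit square
`[p₁, p₁+1] × [p₂, p₂+1] ⊆ ℝ²`. -/
abbrev Cell : Type := ℤ × ℤ

/-- The closed unit square in `ℝ²` corresponding to a cell. -/
def unitSquare (p : Cell) : Set (ℝ × ℝ) :=
  (Set.Icc (p.1 : ℝ) ((p.1 : ℝ) + 1)) ×ˢ (Set.Icc (p.2 : ℝ) ((p.2 : ℝ) + 1))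

/-- The region of the plane covered by a finite set of cells. -/
def Region (S : Finset Cell) : Set (ℝ × ℝ) := ⋃ p ∈ S, unitSquare p

/-- A board: a finite nonempty set of cells whose region is homeomorphic to the
closed unit disk in `ℝ²`. -/
def IsBoard (S : Finset Cell) : Prop :=
  S.Nonempty ∧
    Nonempty ((Region S) ≃ₜ (Metric.closedBall (0 : EuclideanSpace ℝ (Fin 2)) 1))

/-- A cell is black if the sum of its coordinates is even. -/
def IsBlackCell (p : Cell) : Prop := Even (p.1 + p.2)

instance (p : Cell) : Decidable (IsBlackCell p) := by
  unfold IsBlackCell; infer_instance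

/-- The black cells of `S`. -/
def blackCells (S : Finset Cell) : Finset Cell := S.filter IsBlackCell

/-- The white cells of `S`. -/
def whiteCells (S : Finset Cell) : Finset Cell := S.filter fun p => ¬ IsBlackCell p

/-- Two cells are adjacent when they share an edge. -/
def Adjacent (p q : Cell) : Prop :=
  p - q = (1, 0) ∨ p - q = (-1, 0) ∨ p - q = (0, 1) ∨ p - q = (0, -1)

instance (p q : Cell) : Decidable (Adjacent p q) := by
  unfold Adjacent; infer_instance

/-- The black-to-white adjacency matrix of a set of cells, with respect to
labelings `β` of the black cells and `ω` of the white cells. -/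
def btwMatrix {S : Finset Cell} {b w : ℕ}
    (β : Fin b ≃ blackCells S) (ω : Fin w ≃ whiteCells S) :
    Matrix (Fin b) (Fin w) ℤ :=
  fun i j => if Adjacent (β i : Cell) (ω j : Cell) then 1 else 0

/-- The four vertices of a cell. -/
def cellVerts (p : Cell) : Finset Cell := {p, p + (1, 0), p + (0, 1), p + (1, 1)}

/-- `v` is a vertex of `S` if it is a vertex of some cell of `S`. -/
def IsVertex (S : Finset Cell) (v : Cell) : Prop := ∃ p ∈ S, v ∈ cellVerts p

/-- The cells of `S` incident to the vertex `v`. -/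
def incidentCells (S : Finset Cell) (v : Cell) : Finset Cell :=
  S.filter fun p => v ∈ cellVerts p

/-- The point of `ℝ²` corresponding to a grid point. -/
def toR (v : Cell) : ℝ × ℝ := ((v.1 : ℝ), (v.2 : ℝ))

/-- A boundary vertex of `S`: a vertex lying in the topological frontier of the
region of `S`. -/
def IsBoundaryVertex (S : Finset Cell) (v : Cell) : Prop :=
  IsVertex S v ∧ toR v ∈ frontier (Region S)

/-- An interior vertex of `S`: a vertex not lying in the frontier of the region
of `S`. -/
def IsInteriorVertex (S : Finset Cell) (v : Cell) : Prop :=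
  IsVertex S v ∧ toR v ∉ frontier (Region S)

/-- A corner of `S`: a vertex incident to exactly one cell of `S`. -/
def IsBoardCorner (S : Finset Cell) (v : Cell) : Prop := (incidentCells S v).card = 1

/-- `a` and `b` are opposite vertices of the cell `q`. -/
def OppositeVerts (q a b : Cell) : Prop :=
  ({a, b} : Finset Cell) = {q, q + (1, 1)} ∨
    ({a, b} : Finset Cell) = {q + (1, 0), q + (0, 1)}

/-- A pre-diagonal of `S` of length `k`: vertices `v 0, …, v k` and cells
`s 0, …, s (k-1)` as in the definition of a diagonal.  (The values of `v` at
indices `> k` and of `s` at indices `≥ k` are irrelevant.) -/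
def IsPreDiagonal (S : Finset Cell) (k : ℕ) (v : ℕ → Cell) (s : ℕ → Cell) : Prop :=
  1 ≤ k ∧
  IsBoardCorner S (v 0) ∧
  (∀ i, 0 < i → i < k → IsInteriorVertex S (v i)) ∧
  (∀ i, i < k → s i ∈ S) ∧
  (∀ i, i < k → OppositeVerts (s i) (v i) (v (i + 1))) ∧
  (∀ i, i + 1 < k → (cellVerts (s i) ∩ cellVerts (s (i + 1))).card = 1) ∧
  (∀ i j, i ≤ k → j ≤ k → i ≠ j → v i ≠ v j) ∧
  (∀ i j, i < k → j < k → i ≠ j → s i ≠ s j)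

/-- The pre-diagonal `(k', v', s')` extends the pre-diagonal `(k, v, s)`. -/
def PreDiagExtends (k' : ℕ) (v' s' : ℕ → Cell) (k : ℕ) (v s : ℕ → Cell) : Prop :=
  k ≤ k' ∧ (∀ i ≤ k, v' i = v i) ∧ (∀ i < k, s' i = s i)

/-- A diagonal: a pre-diagonal that is maximal under extension. -/
def IsDiagonal (S : Finset Cell) (k : ℕ) (v s : ℕ → Cell) : Prop :=
  IsPreDiagonal S k v s ∧
    ∀ k' v' s', IsPreDiagonal S k' v' s' → PreDiagExtends k' v' s' k v s → k' = k

/-- A good diagonal: at least one of the two unit edges of the last cell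
`s (k-1)` containing the final vertex `v k` is contained in the frontier of the
region of `S`. -/
def IsGoodDiagonal (S : Finset Cell) (k : ℕ) (v s : ℕ → Cell) : Prop :=
  IsDiagonal S k v s ∧
    ∃ a ∈ cellVerts (s (k - 1)),
      (a - v k = (1, 0) ∨ a - v k = (0, 1) ∨ a - v k = (-1, 0) ∨ a - v k = (0, -1)) ∧
      segment ℝ (toR (v k)) (toR a) ⊆ frontier (Region S)

lemma mem_sq (p : Cell) (z : ℝ × ℝ) : z ∈ unitSquare p ↔
    ((p.1 : ℝ) ≤ z.1 ∧ z.1 ≤ p.1 + 1) ∧ ((p.2 : ℝ) ≤ z.2 ∧ z.2 ≤ p.2 + 1) := by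
  simp only [unitSquare, Set.mem_prod, Set.mem_Icc]

lemma mem_region (S : Finset Cell) (z : ℝ × ℝ) :
    z ∈ Region S ↔ ∃ p ∈ S, z ∈ unitSquare p := by
  simp [Region]

lemma isClosed_sq (p : Cell) : IsClosed (unitSquare p) := isClosed_Icc.prod isClosed_Icc

lemma preconn_sq (p : Cell) : IsPreconnected (unitSquare p) :=
  ((convex_Icc _ _).prod (convex_Icc _ _)).isPreconnected

lemma isClosed_region (S : Finset Cell) : IsClosed (Region S) :=
  S.finite_toSet.isClosed_biUnion fun p _ => isClosed_sq p

/-- Every circle-valued map on a space homeomorphic to the disk has a continuous lift. -/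
lemma lift_of_homeo {X : Type*} [TopologicalSpace X]
    (h : X ≃ₜ (Metric.closedBall (0 : EuclideanSpace ℝ (Fin 2)) 1))
    (F : X → AddCircle (1 : ℝ)) (hF : Continuous F) :
    ∃ g : X → ℝ, Continuous g ∧ ∀ x, (g x : AddCircle (1 : ℝ)) = F x := by
  let B := Metric.closedBall (0 : EuclideanSpace ℝ (Fin 2)) 1
  let sc : unitInterval × B → B := fun tb => ⟨(tb.1 : ℝ) • (tb.2 : EuclideanSpace ℝ (Fin 2)), by
    have h1 := tb.1.2.1
    have h2 := tb.1.2.2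
    have h3 := tb.2.2
    simp only [B, Metric.mem_closedBall, dist_zero_right] at h3 ⊢
    rw [norm_smul, Real.norm_of_nonneg h1]
    nlinarith [norm_nonneg (tb.2 : EuclideanSpace ℝ (Fin 2))]⟩
  have hsc : Continuous sc := by
    apply Continuous.subtype_mk
    fun_prop
  let H : C(unitInterval × B, AddCircle (1 : ℝ)) :=
    ⟨fun tb => F (h.symm (sc tb)), hF.comp (h.symm.continuous.comp hsc)⟩
  let z0 : B := ⟨0, by simp [B]⟩
  obtain ⟨e, he⟩ := QuotientAddGroup.mk_surjective (F (h.symm z0))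
  have H0 : ∀ a, H (0, a) = ((ContinuousMap.const B e a : ℝ) : AddCircle (1 : ℝ)) := by
    intro a
    change F (h.symm (sc (0, a))) = _
    have : sc (0, a) = z0 := by
      apply Subtype.ext
      simp [sc, z0]
    rw [this, ← he]
    rfl
  let L := (AddCircle.isCoveringMap_coe (1 : ℝ)).liftHomotopy H (ContinuousMap.const B e) H0
  refine ⟨fun x => L (1, h x), ?_, ?_⟩
  · exact L.continuous.comp (by fun_prop)
  · intro x
    have := congr_fun ((AddCircle.isCoveringMap_coe (1 : ℝ)).liftHomotopy_lifts H
      (ContinuousMap.const B e) H0) (1, h x)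
    refine this.trans ?_
    change F (h.symm (sc (1, h x))) = _
    have : sc (1, h x) = h x := by
      apply Subtype.ext
      simp [sc]
    rw [this]; simp

/-- A convex set with at least three affinely independent points around minus a point. -/
lemma convex_diff_preconnected {W : Set (EuclideanSpace ℝ (Fin 2))} (hW : Convex ℝ W)
    (hint : (interior W).Nonempty) (x : EuclideanSpace ℝ (Fin 2)) :
    IsPreconnected (W \ {x}) := by
  apply isPreconnected_of_forall_pair
  intro a ha b hb
  have seg : ∀ u ∈ W \ {x}, ∀ v ∈ W \ {x}, x ∉ segment ℝ u v →
      segment ℝ u v ⊆ W \ {x} := by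
    intro u hu v hv hx y hy
    refine ⟨hW.segment_subset hu.1 hv.1 hy, ?_⟩
    rintro rfl
    exact hx hy
  have segc : ∀ u v : EuclideanSpace ℝ (Fin 2), IsPreconnected (segment ℝ u v) :=
    fun u v => (convex_segment u v).isPreconnected
  by_cases hx : x ∈ segment ℝ a b
  · -- pick c off the line
    have hab : a ≠ b := by
      rintro rfl
      rw [segment_same] at hx
      exact ha.2 hx.symm
    have hD : ∀ u v y : EuclideanSpace ℝ (Fin 2), y ∈ segment ℝ u v → ∃ s t : ℝ, s + t = 1 ∧
        y = s • u + t • v ∧ y 0 = s * u 0 + t * v 0 ∧ y 1 = s * u 1 + t * v 1 := by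
      rintro u v y ⟨s, t, -, -, hst, rfl⟩
      exact ⟨s, t, hst, rfl, by simp, by simp⟩
    have hpos : 0 < (b 1 - a 1) ^ 2 + (b 0 - a 0) ^ 2 := by
      by_contra hcon
      apply hab
      have h1 : b 1 - a 1 = 0 := by nlinarith [sq_nonneg (b 1 - a 1), sq_nonneg (b 0 - a 0)]
      have h0 : b 0 - a 0 = 0 := by nlinarith [sq_nonneg (b 1 - a 1), sq_nonneg (b 0 - a 0)]
      ext i
      fin_cases i
      · simp; linarith
      · simp; linarith
    have hc : ∃ c ∈ W, (c 0 - a 0) * (b 1 - a 1) - (c 1 - a 1) * (b 0 - a 0) ≠ 0 := by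
      obtain ⟨w, hw⟩ := hint
      by_cases hw0 : (w 0 - a 0) * (b 1 - a 1) - (w 1 - a 1) * (b 0 - a 0) = 0
      · let n : EuclideanSpace ℝ (Fin 2) := !₂[b 1 - a 1, -(b 0 - a 0)]
        have hcont : Continuous fun t : ℝ => w + t • n := by fun_prop
        have hnear : ∀ᶠ t : ℝ in nhds 0, w + t • n ∈ W := by
          apply hcont.continuousAt.eventually_mem
          simpa using mem_interior_iff_mem_nhds.mp hw
        have hnear' : ∀ᶠ t : ℝ in nhdsWithin 0 (Set.Ioi 0), w + t • n ∈ W :=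
          nhdsWithin_le_nhds hnear
        obtain ⟨t, ht, ht0⟩ := (hnear'.and self_mem_nhdsWithin).exists
        refine ⟨_, ht, ?_⟩
        have ht0 : 0 < t := ht0
        have e0 : (w + t • n) 0 = w 0 + t * (b 1 - a 1) := by simp [n]
        have e1 : (w + t • n) 1 = w 1 - t * (b 0 - a 0) := by simp [n]; ring
        rw [e0, e1]
        have : 0 < t * ((b 1 - a 1) ^ 2 + (b 0 - a 0) ^ 2) := mul_pos ht0 hpos
        nlinarith
      · exact ⟨w, interior_subset hw, hw0⟩
    obtain ⟨c, hcW, hcD⟩ := hc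
    have hxD : (x 0 - a 0) * (b 1 - a 1) - (x 1 - a 1) * (b 0 - a 0) = 0 := by
      obtain ⟨s, t, hst, -, e0, e1⟩ := hD _ _ _ hx
      obtain rfl : s = 1 - t := by linarith
      rw [e0, e1]; ring
    have hcx : c ∈ W \ {x} := ⟨hcW, by rintro rfl; exact hcD hxD⟩
    have h1 : x ∉ segment ℝ a c := by
      intro hxs
      obtain ⟨s, t, hst, e, e0, e1⟩ := hD _ _ _ hxs
      obtain rfl : s = 1 - t := by linarith
      have : t * ((c 0 - a 0) * (b 1 - a 1) - (c 1 - a 1) * (b 0 - a 0)) = 0 := by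
        rw [← hxD, e0, e1]; ring
      have ht : t = 0 := (mul_eq_zero.mp this).resolve_right hcD
      apply ha.2
      rw [e, ht]; simp
    have h2 : x ∉ segment ℝ c b := by
      intro hxs
      obtain ⟨s, t, hst, e, e0, e1⟩ := hD _ _ _ hxs
      obtain rfl : t = 1 - s := by linarith
      have : s * ((c 0 - a 0) * (b 1 - a 1) - (c 1 - a 1) * (b 0 - a 0)) = 0 := by
        rw [← hxD, e0, e1]; ring
      have ht : s = 0 := (mul_eq_zero.mp this).resolve_right hcD
      apply hb.2
      rw [e, ht]; simp
    refine ⟨segment ℝ a c ∪ segment ℝ c b, Set.union_subset (seg a ha c hcx h1)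
      (seg c hcx b hb h2), Or.inl (left_mem_segment _ _ _), Or.inr (right_mem_segment _ _ _), ?_⟩
    exact IsPreconnected.union c (right_mem_segment _ _ _) (left_mem_segment _ _ _)
      (segc _ _) (segc _ _)
  · exact ⟨segment ℝ a b, seg a ha b hb hx, left_mem_segment _ _ _, right_mem_segment _ _ _,
      segc _ _⟩

/-- Points of a disk do not locally separate it. -/
lemma local_nonsep {X : Type*} [TopologicalSpace X]
    (h : X ≃ₜ (Metric.closedBall (0 : EuclideanSpace ℝ (Fin 2)) 1))
    (x : X) (U : Set X) (hU : U ∈ nhds x) :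
    ∃ W ∈ nhds x, W ⊆ U ∧ IsPreconnected (W \ {x}) := by
  let B := Metric.closedBall (0 : EuclideanSpace ℝ (Fin 2)) 1
  have h1 : h.symm ⁻¹' U ∈ nhds (h x) :=
    h.symm.continuous.continuousAt.preimage_mem_nhds (by simpa using hU)
  obtain ⟨r, hr, hrU⟩ := Metric.mem_nhds_iff.mp h1
  let y : EuclideanSpace ℝ (Fin 2) := (h x : B)
  let K : Set (EuclideanSpace ℝ (Fin 2)) := Metric.ball y r ∩ B
  have hK : Convex ℝ K := (convex_ball _ _).inter (convex_closedBall _ _)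
  have hint : (interior K).Nonempty := by
    have hy : y ∈ closure (Metric.ball (0 : EuclideanSpace ℝ (Fin 2)) 1) := by
      rw [closure_ball _ one_ne_zero]; exact (h x).2
    obtain ⟨w, hw1, hw2⟩ := mem_closure_iff.mp hy (Metric.ball y r) Metric.isOpen_ball
      (Metric.mem_ball_self hr)
    refine ⟨w, mem_interior.mpr ⟨Metric.ball y r ∩ Metric.ball 0 1,
      Set.inter_subset_inter_right _ Metric.ball_subset_closedBall,
      Metric.isOpen_ball.inter Metric.isOpen_ball, hw1, hw2⟩⟩
  have hpre := convex_diff_preconnected hK hint y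
  refine ⟨h ⁻¹' Metric.ball (h x) r, h.continuous.continuousAt.preimage_mem_nhds
    (Metric.ball_mem_nhds _ hr), ?_, ?_⟩
  · intro z hz
    have := hrU hz
    simpa using this
  · have e : h ⁻¹' Metric.ball (h x) r \ {x} =
        h ⁻¹' ((Subtype.val : B → EuclideanSpace ℝ (Fin 2)) ⁻¹' (K \ {y})) := by
      ext z
      have hz : (h z : EuclideanSpace ℝ (Fin 2)) ∈ B := (h z).2
      have hzx : z = x ↔ (h z : EuclideanSpace ℝ (Fin 2)) = y := by
        rw [← h.injective.eq_iff, Subtype.ext_iff]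
      simp only [Set.mem_sdiff, Set.mem_preimage, Set.mem_singleton_iff, K, Set.mem_inter_iff,
        hz, and_true, hzx]
      rfl
    rw [e, h.isPreconnected_preimage]
    refine (Topology.IsInducing.subtypeVal.isPreconnected_image).mp ?_
    rw [Subtype.image_preimage_coe, Set.inter_eq_right.mpr]
    · exact hpre
    · exact fun z hz => hz.1.2

lemma no_pinch {S : Finset Cell}
    (h : Region S ≃ₜ (Metric.closedBall (0 : EuclideanSpace ℝ (Fin 2)) 1))
    (v : Cell) (σ : ℝ) (u : ℝ × ℝ)
    (hL : ∀ z ∈ Region S, |z.1 - v.1| < 1 → |z.2 - v.2| < 1 →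
      (z.1 - v.1) + σ * (z.2 - v.2) = 0 → z = toR v)
    (hu : 0 < u.1 + σ * u.2)
    (hin : ∀ t : ℝ, |t| < 1 → toR v + t • u ∈ Region S) : False := by
  have hv : toR v ∈ Region S := by simpa using hin 0 (by simp)
  let x : Region S := ⟨toR v, hv⟩
  let U : Set (Region S) := {z | |z.1.1 - v.1| < 1 ∧ |z.1.2 - v.2| < 1}
  have hU : U ∈ nhds x := by
    apply IsOpen.mem_nhds
    · have c1 : IsOpen {z : Region S | |z.1.1 - (v.1 : ℝ)| < 1} :=
        isOpen_lt (by fun_prop) (by fun_prop)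
      have c2 : IsOpen {z : Region S | |z.1.2 - (v.2 : ℝ)| < 1} :=
        isOpen_lt (by fun_prop) (by fun_prop)
      exact c1.inter c2
    · simp [U, x, toR]
  obtain ⟨W, hW, hWU, hpre⟩ := local_nonsep h x U hU
  obtain ⟨O, hO, hOW⟩ := (mem_nhds_subtype _ _ _).mp hW
  have hcont : Continuous fun t : ℝ => toR v + t • u := by fun_prop
  have hnear : ∀ᶠ t : ℝ in nhds 0, toR v + t • u ∈ O := by
    apply hcont.continuousAt.eventually_mem
    simpa using hO
  obtain ⟨ε, hε, hεO⟩ := Metric.eventually_nhds_iff.mp hnear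
  let t := min ε 1 / 2
  have ht0 : 0 < t := by positivity
  have htε : t < ε := by
    have := min_le_left ε 1
    simp only [t]; linarith
  have ht1 : t < 1 := by
    have := min_le_right ε 1
    simp only [t]; linarith
  have key : ∀ s : ℝ, |s| = t → ∃ a ∈ W \ {x},
      (a.1.1 - v.1) + σ * (a.1.2 - v.2) = s * (u.1 + σ * u.2) := by
    intro s hs
    refine ⟨⟨toR v + s • u, hin s (by rw [hs]; exact ht1)⟩, ⟨hOW ?_, ?_⟩, ?_⟩
    · exact hεO (by simpa [hs] using htε)
    · intro hx
      have hx : toR v + s • u = toR v := congrArg Subtype.val hx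
      have hx : s • u = 0 := by simpa using hx
      have hs0 : s ≠ 0 := by
        rintro rfl
        simp at hs; linarith
      have : u = 0 := (smul_eq_zero.mp hx).resolve_left hs0
      rw [this] at hu
      simp at hu
    · simp [toR]; ring
  obtain ⟨a, ha, hae⟩ := key t (abs_of_pos ht0)
  obtain ⟨b, hb, hbe⟩ := key (-t) (by rw [abs_neg, abs_of_pos ht0])
  have hfc : Continuous fun z : Region S => (z.1.1 - v.1) + σ * (z.1.2 - v.2) := by fun_prop
  have := hpre.intermediate_value hb ha hfc.continuousOn
  have hpos := mul_pos ht0 hu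
  obtain ⟨z, hz, hz0⟩ := this (show (0 : ℝ) ∈ Set.Icc _ _ by
    simp only [Set.mem_Icc, hae, hbe]
    constructor <;> linarith)
  have hzU := hWU hz.1
  exact hz.2 (Subtype.ext (hL z.1 z.2 hzU.1 hzU.2 hz0))

/-- A square that meets a box around `v` is one of the four squares at `v`. -/
lemma near_cell (v p : Cell) (z : ℝ × ℝ) (hz : z ∈ unitSquare p) (h1 : |z.1 - v.1| < 1)
    (h2 : |z.2 - v.2| < 1) :
    (p.1 = v.1 ∨ p.1 = v.1 - 1) ∧ (p.2 = v.2 ∨ p.2 = v.2 - 1) := by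
  rw [mem_sq] at hz
  rw [abs_lt] at h1 h2
  have a1 : (p.1 : ℝ) < v.1 + 1 := by linarith
  have a2 : (v.1 : ℝ) < p.1 + 2 := by linarith
  have a3 : (p.2 : ℝ) < v.2 + 1 := by linarith
  have a4 : (v.2 : ℝ) < p.2 + 2 := by linarith
  norm_cast at a1 a2 a3 a4
  omega

lemma no_pinch1 {S : Finset Cell}
    (h : Region S ≃ₜ (Metric.closedBall (0 : EuclideanSpace ℝ (Fin 2)) 1)) (x y : ℤ)
    (h1 : (x, y) ∈ S) (h2 : (x - 1, y - 1) ∈ S) (h3 : (x - 1, y) ∉ S)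
    (h4 : (x, y - 1) ∉ S) : False := by
  apply no_pinch h (x, y) 1 (1, 1)
  · intro z hz b1 b2 hzero
    obtain ⟨⟨p1, p2⟩, hp, hzp⟩ := (mem_region _ _).mp hz
    obtain ⟨c1, c2⟩ := near_cell _ _ _ hzp b1 b2
    rw [mem_sq] at hzp
    simp only at c1 c2 hzp hzero
    rcases c1 with rfl | rfl <;> rcases c2 with rfl | rfl
    · apply Prod.ext <;> simp only [toR] <;> linarith
    · exact absurd hp h4
    · exact absurd hp h3
    · push_cast at hzp
      apply Prod.ext <;> simp only [toR] <;> linarith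
  · norm_num
  · intro t ht
    rw [abs_lt] at ht
    rw [mem_region]
    rcases le_total 0 t with h0 | h0
    · exact ⟨_, h1, by
        rw [mem_sq]; simp only [toR, Prod.fst_add, Prod.snd_add, Prod.smul_fst, Prod.smul_snd,
          smul_eq_mul]; push_cast; refine ⟨⟨?_, ?_⟩, ?_, ?_⟩ <;> linarith⟩
    · exact ⟨_, h2, by
        rw [mem_sq]; simp only [toR, Prod.fst_add, Prod.snd_add, Prod.smul_fst, Prod.smul_snd,
          smul_eq_mul]; push_cast; refine ⟨⟨?_, ?_⟩, ?_, ?_⟩ <;> linarith⟩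

lemma no_pinch2 {S : Finset Cell}
    (h : Region S ≃ₜ (Metric.closedBall (0 : EuclideanSpace ℝ (Fin 2)) 1)) (x y : ℤ)
    (h1 : (x, y) ∉ S) (h2 : (x - 1, y - 1) ∉ S) (h3 : (x - 1, y) ∈ S)
    (h4 : (x, y - 1) ∈ S) : False := by
  apply no_pinch h (x, y) (-1) (1, -1)
  · intro z hz b1 b2 hzero
    obtain ⟨⟨p1, p2⟩, hp, hzp⟩ := (mem_region _ _).mp hz
    obtain ⟨c1, c2⟩ := near_cell _ _ _ hzp b1 b2
    rw [mem_sq] at hzp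
    simp only at c1 c2 hzp hzero
    rcases c1 with rfl | rfl <;> rcases c2 with rfl | rfl
    · exact absurd hp h1
    · push_cast at hzp
      apply Prod.ext <;> simp only [toR] <;> linarith
    · push_cast at hzp
      apply Prod.ext <;> simp only [toR] <;> linarith
    · exact absurd hp h2
  · norm_num
  · intro t ht
    rw [abs_lt] at ht
    rw [mem_region]
    rcases le_total 0 t with h0 | h0
    · exact ⟨_, h4, by
        rw [mem_sq]; simp only [toR, Prod.fst_add, Prod.snd_add, Prod.smul_fst, Prod.smul_snd,
          smul_eq_mul]; push_cast; refine ⟨⟨?_, ?_⟩, ?_, ?_⟩ <;> linarith⟩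
    · exact ⟨_, h3, by
        rw [mem_sq]; simp only [toR, Prod.fst_add, Prod.snd_add, Prod.smul_fst, Prod.smul_snd,
          smul_eq_mul]; push_cast; refine ⟨⟨?_, ?_⟩, ?_, ?_⟩ <;> linarith⟩

lemma isVertex_iff (S : Finset Cell) (v : Cell) : IsVertex S v ↔
    (v.1, v.2) ∈ S ∨ (v.1 - 1, v.2) ∈ S ∨ (v.1, v.2 - 1) ∈ S ∨ (v.1 - 1, v.2 - 1) ∈ S := by
  obtain ⟨x, y⟩ := v
  constructor
  · rintro ⟨⟨p, q⟩, hp, hv⟩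
    simp only [cellVerts, Finset.mem_insert, Finset.mem_singleton, Prod.mk_add_mk,
      Prod.mk.injEq] at hv
    rcases hv with ⟨rfl, rfl⟩ | ⟨rfl, rfl⟩ | ⟨rfl, rfl⟩ | ⟨rfl, rfl⟩ <;> simp [hp]
  · rintro (h | h | h | h)
    all_goals exact ⟨_, h, by simp [cellVerts]⟩

lemma open_cell {S : Finset Cell} (c : Cell) (z : ℝ × ℝ) (hz : z ∈ Region S)
    (h1 : (c.1 : ℝ) < z.1) (h2 : z.1 < c.1 + 1) (h3 : (c.2 : ℝ) < z.2) (h4 : z.2 < c.2 + 1) :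
    c ∈ S := by
  obtain ⟨p, hp, hzp⟩ := (mem_region _ _).mp hz
  rw [mem_sq] at hzp
  have a1 : (p.1 : ℝ) < c.1 + 1 := by linarith
  have a2 : (c.1 : ℝ) < p.1 + 1 := by linarith
  have a3 : (p.2 : ℝ) < c.2 + 1 := by linarith
  have a4 : (c.2 : ℝ) < p.2 + 1 := by linarith
  norm_cast at a1 a2 a3 a4
  have : p = c := Prod.ext (by omega) (by omega)
  exact this ▸ hp

lemma not_frontier_iff (S : Finset Cell) (v : Cell) (hv : IsVertex S v) :
    toR v ∉ frontier (Region S) ↔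
    (v.1, v.2) ∈ S ∧ (v.1 - 1, v.2) ∈ S ∧ (v.1, v.2 - 1) ∈ S ∧ (v.1 - 1, v.2 - 1) ∈ S := by
  have hmem : toR v ∈ Region S := by
    rw [isVertex_iff] at hv
    rw [mem_region]
    rcases hv with h | h | h | h
    all_goals exact ⟨_, h, by rw [mem_sq]; simp [toR]⟩
  rw [(isClosed_region S).frontier_eq]
  simp only [Set.mem_sdiff, hmem, true_and, not_not]
  constructor
  · intro hint
    have key : ∀ u : ℝ × ℝ, ∃ t : ℝ, 0 < t ∧ t < 1 ∧ toR v + t • u ∈ Region S := by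
      intro u
      have hcont : Continuous fun t : ℝ => toR v + t • u := by fun_prop
      have hnear : ∀ᶠ t : ℝ in nhds 0, toR v + t • u ∈ Region S := by
        apply hcont.continuousAt.eventually_mem
        simpa using mem_interior_iff_mem_nhds.mp hint
      have hnear' : ∀ᶠ t : ℝ in nhdsWithin 0 (Set.Ioi 0), toR v + t • u ∈ Region S :=
        nhdsWithin_le_nhds hnear
      obtain ⟨t, ht, ht0⟩ := (hnear'.and (Ioo_mem_nhdsGT (zero_lt_one' ℝ))).exists
      exact ⟨t, ht0.1, ht0.2, ht⟩
    refine ⟨?_, ?_, ?_, ?_⟩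
    · obtain ⟨t, h0, h1, ht⟩ := key (1, 1)
      apply open_cell _ _ ht <;> simp [toR] <;> linarith
    · obtain ⟨t, h0, h1, ht⟩ := key (-1, 1)
      apply open_cell _ _ ht <;> simp [toR] <;> linarith
    · obtain ⟨t, h0, h1, ht⟩ := key (1, -1)
      apply open_cell _ _ ht <;> simp [toR] <;> linarith
    · obtain ⟨t, h0, h1, ht⟩ := key (-1, -1)
      apply open_cell _ _ ht <;> simp [toR] <;> linarith
  · rintro ⟨h1, h2, h3, h4⟩
    refine mem_interior.mpr ⟨Set.Ioo ((v.1 : ℝ) - 1) (v.1 + 1) ×ˢ Set.Ioo ((v.2 : ℝ) - 1) (v.2 + 1),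
      ?_, isOpen_Ioo.prod isOpen_Ioo, ?_⟩
    · rintro ⟨a, b⟩ ⟨⟨ha1, ha2⟩, hb1, hb2⟩
      simp only at ha1 ha2 hb1 hb2
      rw [mem_region]
      rcases le_total (v.1 : ℝ) a with ha | ha <;> rcases le_total (v.2 : ℝ) b with hb | hb
      · exact ⟨_, h1, by rw [mem_sq]; push_cast; refine ⟨⟨?_, ?_⟩, ?_, ?_⟩ <;> linarith⟩
      · exact ⟨_, h3, by rw [mem_sq]; push_cast; refine ⟨⟨?_, ?_⟩, ?_, ?_⟩ <;> linarith⟩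
      · exact ⟨_, h2, by rw [mem_sq]; push_cast; refine ⟨⟨?_, ?_⟩, ?_, ?_⟩ <;> linarith⟩
      · exact ⟨_, h4, by rw [mem_sq]; push_cast; refine ⟨⟨?_, ?_⟩, ?_, ?_⟩ <;> linarith⟩
    · constructor <;> constructor <;> simp [toR]

lemma region_preconn {S : Finset Cell}
    (h : Region S ≃ₜ (Metric.closedBall (0 : EuclideanSpace ℝ (Fin 2)) 1)) :
    IsPreconnected (Region S) := by
  have hB : IsPreconnected (Metric.closedBall (0 : EuclideanSpace ℝ (Fin 2)) 1) :=
    (convex_closedBall _ _).isPreconnected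
  rw [isPreconnected_iff_preconnectedSpace] at hB ⊢
  refine ⟨?_⟩
  have := h.isPreconnected_preimage.mpr hB.isPreconnected_univ
  simpa using this

/-- A function that is constant on each cell is constant. -/
lemma const_of_cell {S : Finset Cell} (hS : IsPreconnected (Region S)) (f : Cell → ℤ)
    (hf : ∀ x y : ℤ, (x, y) ∈ S → f (x + 1, y) = f (x, y) ∧ f (x, y + 1) = f (x, y) ∧
      f (x + 1, y + 1) = f (x, y)) (p q : Cell) (hp : p ∈ S) (hq : q ∈ S) : f p = f q := by
  by_contra hne
  have hsplit : Region S ⊆ Region (S.filter fun r => f r = f p) ∪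
      Region (S.filter fun r => f r ≠ f p) := by
    intro z hz
    obtain ⟨r, hr, hzr⟩ := (mem_region _ _).mp hz
    by_cases hrp : f r = f p
    · exact Or.inl ((mem_region _ _).mpr ⟨r, by simp [hr, hrp], hzr⟩)
    · exact Or.inr ((mem_region _ _).mpr ⟨r, by simp [hr, hrp], hzr⟩)
  have hc : ∀ r : Cell, toR r ∈ unitSquare r := fun r => by rw [mem_sq]; simp [toR]
  obtain ⟨z, -, hz1, hz2⟩ := isPreconnected_closed_iff.mp hS _ _ (isClosed_region _)
    (isClosed_region _) hsplit
    ⟨toR p, (mem_region _ _).mpr ⟨p, hp, hc p⟩, (mem_region _ _).mpr ⟨p, by simp [hp], hc p⟩⟩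
    ⟨toR q, (mem_region _ _).mpr ⟨q, hq, hc q⟩,
      (mem_region _ _).mpr ⟨q, by simp [hq, Ne.symm hne], hc q⟩⟩
  obtain ⟨⟨a, b⟩, hr, hzr⟩ := (mem_region _ _).mp hz1
  obtain ⟨⟨c, d⟩, hs, hzs⟩ := (mem_region _ _).mp hz2
  simp only [Finset.mem_filter] at hr hs
  apply hs.2
  rw [← hr.2]
  have f1 := hf a b hr.1
  have f2 := hf c d hs.1
  rw [mem_sq] at hzr hzs
  simp only at hzr hzs
  have a1 : (a : ℝ) ≤ c + 1 := by linarith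
  have a2 : (c : ℝ) ≤ a + 1 := by linarith
  have a3 : (b : ℝ) ≤ d + 1 := by linarith
  have a4 : (d : ℝ) ≤ b + 1 := by linarith
  norm_cast at a1 a2 a3 a4
  have b1 : a = c ∨ a = c + 1 ∨ c = a + 1 := by omega
  have b2 : b = d ∨ b = d + 1 ∨ d = b + 1 := by omega
  rcases b1 with rfl | rfl | rfl <;> rcases b2 with rfl | rfl | rfl <;> grind

/-- The bilinear interpolation of the local potential of `(a, b)` on the cell `p`. -/
noncomputable def phi (a b : Cell → ℤ) (p : Cell) (z : ℝ × ℝ) : ℝ :=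
  (z.1 - p.1) * a p + (z.2 - p.2) * b p +
    (z.1 - p.1) * (z.2 - p.2) * (b (p.1 + 1, p.2) - b p)

lemma phi_compat {S : Finset Cell} (a b : Cell → ℤ)
    (hab : ∀ x y : ℤ, (x, y) ∈ S → a (x, y) + b (x + 1, y) = b (x, y) + a (x, y + 1))
    (p q : Cell) (hp : p ∈ S) (hq : q ∈ S) (z : ℝ × ℝ) (hzp : z ∈ unitSquare p)
    (hzq : z ∈ unitSquare q) : ∃ n : ℤ, phi a b p z - phi a b q z = n := by
  obtain ⟨x, y⟩ := p
  obtain ⟨c, d⟩ := q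
  obtain ⟨s, t⟩ := z
  have f1 := hab x y hp
  have f2 := hab c d hq
  rw [mem_sq] at hzp hzq
  simp only at hzp hzq
  have a1 : (x : ℝ) ≤ c + 1 := by linarith
  have a2 : (c : ℝ) ≤ x + 1 := by linarith
  have a3 : (y : ℝ) ≤ d + 1 := by linarith
  have a4 : (d : ℝ) ≤ y + 1 := by linarith
  norm_cast at a1 a2 a3 a4
  have b1 : x = c ∨ x = c + 1 ∨ c = x + 1 := by omega
  have b2 : y = d ∨ y = d + 1 ∨ d = y + 1 := by omega
  have f1' : (a (x, y) + b (x + 1, y) : ℝ) = b (x, y) + a (x, y + 1) := by exact_mod_cast f1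
  have f2' : (a (c, d) + b (c + 1, d) : ℝ) = b (c, d) + a (c, d + 1) := by exact_mod_cast f2
  clear f1 f2
  rcases b1 with rfl | rfl | rfl <;> rcases b2 with rfl | rfl | rfl <;> push_cast at * <;>
    simp only [phi] <;> push_cast
  · exact ⟨0, by simp⟩
  · obtain rfl : t = d + 1 := by linarith
    exact ⟨-b (x, d), by push_cast; linear_combination (-(s - x)) * f2'⟩
  · obtain rfl : t = y + 1 := by linarith
    exact ⟨b (x, y), by push_cast; linear_combination ((s - x)) * f1'⟩
  · obtain rfl : s = c + 1 := by linarith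
    exact ⟨-a (c, y), by push_cast; ring⟩
  · obtain rfl : s = c + 1 := by linarith
    obtain rfl : t = d + 1 := by linarith
    exact ⟨-a (c, d) - b (c + 1, d), by push_cast; ring⟩
  · obtain rfl : s = c + 1 := by linarith
    obtain rfl : t = y + 1 := by linarith
    exact ⟨b (c + 1, y) - a (c, y + 1), by push_cast; ring⟩
  · obtain rfl : s = x + 1 := by linarith
    exact ⟨a (x, y), by push_cast; ring⟩
  · obtain rfl : s = x + 1 := by linarith
    obtain rfl : t = d + 1 := by linarith
    exact ⟨a (x, d + 1) - b (x + 1, d), by push_cast; ring⟩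
  · obtain rfl : s = x + 1 := by linarith
    obtain rfl : t = y + 1 := by linarith
    exact ⟨a (x, y) + b (x + 1, y), by push_cast; ring⟩

lemma circle_eq_iff (r s : ℝ) : (r : AddCircle (1 : ℝ)) = s ↔ ∃ n : ℤ, r - s = n := by
  rw [← sub_eq_zero, ← AddCircle.coe_sub, AddCircle.coe_eq_zero_iff]
  simp only [zsmul_eq_mul, mul_one, eq_comm]

/-- Closed integral cochains on a board are exact. -/
lemma exact_of_closed {S : Finset Cell}
    (h : Region S ≃ₜ (Metric.closedBall (0 : EuclideanSpace ℝ (Fin 2)) 1))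
    (a b : Cell → ℤ)
    (hab : ∀ x y : ℤ, (x, y) ∈ S → a (x, y) + b (x + 1, y) = b (x, y) + a (x, y + 1)) :
    ∃ f : Cell → ℤ, ∀ x y : ℤ, (x, y) ∈ S →
      f (x + 1, y) - f (x, y) = a (x, y) ∧ f (x, y + 1) - f (x, y) = b (x, y) ∧
      f (x + 1, y + 1) - f (x, y + 1) = a (x, y + 1) ∧
      f (x + 1, y + 1) - f (x + 1, y) = b (x + 1, y) := by
  have hex : ∀ z : Region S, ∃ p ∈ S, z.1 ∈ unitSquare p := fun z => (mem_region _ _).mp z.2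
  choose P hPS hPz using hex
  let F : Region S → AddCircle (1 : ℝ) := fun z => (phi a b (P z) z.1 : ℝ)
  have hF : ∀ p ∈ S, ∀ z : Region S, z.1 ∈ unitSquare p → F z = (phi a b p z.1 : ℝ) := by
    intro p hp z hz
    exact (circle_eq_iff _ _).mpr (phi_compat a b hab _ _ (hPS z) hp _ (hPz z) hz)
  have hphi : ∀ p, Continuous (phi a b p) := by
    intro p
    unfold phi
    fun_prop
  have hFc : Continuous F := by
    refine (locallyFinite_of_finite (fun p : S => {z : Region S | z.1 ∈ unitSquare p.1})).continuous
      ?_ ?_ ?_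
    · ext z
      simpa using ⟨(P z).1, (P z).2, hPS z, hPz z⟩
    · intro p
      exact (isClosed_sq p.1).preimage continuous_subtype_val
    · intro p
      have : Continuous fun z : Region S => ((phi a b p.1 z.1 : ℝ) : AddCircle (1 : ℝ)) :=
        (AddCircle.continuous_mk' 1).comp ((hphi p.1).comp continuous_subtype_val)
      exact this.continuousOn.congr fun z hz => hF p.1 p.2 z hz
  obtain ⟨g, hg, hgF⟩ := lift_of_homeo h F hFc
  classical
  let G : ℝ × ℝ → ℝ := fun z => if hz : z ∈ Region S then g ⟨z, hz⟩ else 0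
  have hG : ContinuousOn G (Region S) := by
    rw [continuousOn_iff_continuous_domRestrict]
    convert hg using 1
    ext z
    simp [G]
  have hGF : ∀ p ∈ S, ∀ z ∈ unitSquare p, ∃ n : ℤ, G z - phi a b p z = n := by
    intro p hp z hz
    have hzS : z ∈ Region S := (mem_region _ _).mpr ⟨p, hp, hz⟩
    rw [← circle_eq_iff]
    simp only [G, hzS, dif_pos]
    rw [hgF, hF p hp ⟨z, hzS⟩ hz]
  have hconst : ∀ p ∈ S, ∀ z ∈ unitSquare p, ∀ w ∈ unitSquare p,
      G z - phi a b p z = G w - phi a b p w := by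
    intro p hp z hz w hw
    have hsub : unitSquare p ⊆ Region S := fun y hy => (mem_region _ _).mpr ⟨p, hp, hy⟩
    have hc : ContinuousOn (fun z => G z - phi a b p z) (unitSquare p) :=
      (hG.mono hsub).sub (hphi p).continuousOn
    have hcr := hc.norm
    have himg := ((preconn_sq p).image _ hc)
    by_contra hne
    wlog hlt : G z - phi a b p z < G w - phi a b p w generalizing z w
    · exact this w hw z hz (Ne.symm hne) (lt_of_le_of_ne (not_lt.mp hlt) (Ne.symm hne))
    obtain ⟨n, hn⟩ := hGF p hp z hz
    obtain ⟨m, hm⟩ := hGF p hp w hw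
    have hnm : n < m := by
      rw [hn, hm] at hlt
      exact_mod_cast hlt
    have hnm' : (n : ℝ) + 1 ≤ m := by exact_mod_cast hnm
    obtain ⟨y, hy, hyv⟩ := (preconn_sq p).intermediate_value hz hw hc
      (show (n : ℝ) + 1 / 2 ∈ Set.Icc _ _ by
        simp only [hn, hm, Set.mem_Icc]
        constructor <;> linarith)
    obtain ⟨k, hk⟩ := hGF p hp y hy
    simp only at hyv
    rw [hk] at hyv
    have h1 : (n : ℝ) < k := by linarith
    have h2 : (k : ℝ) < n + 1 := by linarith
    norm_cast at h1 h2
    omega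
  have hint : ∀ x y : ℤ, (x, y) ∈ S → ∀ i j : ℤ, (i = 0 ∨ i = 1) → (j = 0 ∨ j = 1) →
      ((round (G (toR (x + i, y + j))) : ℤ) : ℝ) = G (toR (x + i, y + j)) := by
    intro x y hp i j hi hj
    obtain ⟨n, hn⟩ := hGF _ hp (toR (x + i, y + j)) (by
      rw [mem_sq]
      rcases hi with rfl | rfl <;> rcases hj with rfl | rfl <;> simp [toR])
    have : ∃ m : ℤ, G (toR (x + i, y + j)) = m := by
      refine ⟨n + (i * a (x, y) + j * b (x, y) + i * j * (b (x + 1, y) - b (x, y))), ?_⟩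
      rw [sub_eq_iff_eq_add] at hn
      rw [hn]
      simp [phi, toR]
    obtain ⟨m, hm⟩ := this
    rw [hm, round_intCast]
  refine ⟨fun v => round (G (toR v)), fun x y hp => ?_⟩
  have hm : ∀ i j : ℤ, (i = 0 ∨ i = 1) → (j = 0 ∨ j = 1) →
      toR (x + i, y + j) ∈ unitSquare (x, y) := by
    intro i j hi hj
    rw [mem_sq]
    rcases hi with rfl | rfl <;> rcases hj with rfl | rfl <;> simp [toR]
  have i00 := hint x y hp 0 0 (by simp) (by simp)
  have i10 := hint x y hp 1 0 (by simp) (by simp)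
  have i01 := hint x y hp 0 1 (by simp) (by simp)
  have i11 := hint x y hp 1 1 (by simp) (by simp)
  have c10 := hconst _ hp _ (hm 1 0 (by simp) (by simp)) _ (hm 0 0 (by simp) (by simp))
  have c01 := hconst _ hp _ (hm 0 1 (by simp) (by simp)) _ (hm 0 0 (by simp) (by simp))
  have c11 := hconst _ hp _ (hm 1 1 (by simp) (by simp)) _ (hm 0 0 (by simp) (by simp))
  rw [← i00, ← i10] at c10
  rw [← i00, ← i01] at c01
  rw [← i00, ← i11] at c11
  clear i00 i10 i01 i11
  have p00 : phi a b (x, y) (toR (x + 0, y + 0)) = ((0 : ℤ) : ℝ) := by simp [phi, toR]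
  have p10 : phi a b (x, y) (toR (x + 1, y + 0)) = (a (x, y) : ℝ) := by simp [phi, toR]
  have p01 : phi a b (x, y) (toR (x + 0, y + 1)) = (b (x, y) : ℝ) := by simp [phi, toR]
  have p11 : phi a b (x, y) (toR (x + 1, y + 1)) = ((a (x, y) + b (x + 1, y) : ℤ) : ℝ) := by
    simp [phi, toR]
  rw [p00, p10] at c10
  rw [p00, p01] at c01
  rw [p00, p11] at c11
  norm_cast at c10 c01 c11
  simp only [add_zero] at c10 c01 c11
  have f1 := hab x y hp
  refine ⟨?_, ?_, ?_, ?_⟩ <;> linarith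

section Euler

variable (S : Finset Cell)

/-- Horizontal edges of `S`, indexed by their left end. -/
def hEdges : Finset Cell := S ∪ S.image fun p => (p.1, p.2 + 1)

/-- Vertical edges of `S`, indexed by their lower end. -/
def vEdges : Finset Cell := S ∪ S.image fun p => (p.1 + 1, p.2)

/-- Vertices of `S`. -/
def verts : Finset Cell := S ∪ S.image (fun p => (p.1 + 1, p.2)) ∪
  S.image (fun p => (p.1, p.2 + 1)) ∪ S.image (fun p => (p.1 + 1, p.2 + 1))

lemma mem_hEdges (x y : ℤ) : (x, y) ∈ hEdges S ↔ (x, y) ∈ S ∨ (x, y - 1) ∈ S := by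
  simp only [hEdges, Finset.mem_union, Finset.mem_image, Prod.exists, Prod.mk.injEq]
  constructor
  · rintro (h | ⟨a, b, h, rfl, rfl⟩)
    · exact Or.inl h
    · right; simpa using h
  · rintro (h | h)
    · exact Or.inl h
    · exact Or.inr ⟨_, _, h, rfl, by ring⟩

lemma mem_vEdges (x y : ℤ) : (x, y) ∈ vEdges S ↔ (x, y) ∈ S ∨ (x - 1, y) ∈ S := by
  simp only [vEdges, Finset.mem_union, Finset.mem_image, Prod.exists, Prod.mk.injEq]
  constructor
  · rintro (h | ⟨a, b, h, rfl, rfl⟩)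
    · exact Or.inl h
    · right; simpa using h
  · rintro (h | h)
    · exact Or.inl h
    · exact Or.inr ⟨_, _, h, by ring, rfl⟩

lemma mem_verts (x y : ℤ) : (x, y) ∈ verts S ↔
    (x, y) ∈ S ∨ (x - 1, y) ∈ S ∨ (x, y - 1) ∈ S ∨ (x - 1, y - 1) ∈ S := by
  simp only [verts, Finset.mem_union, Finset.mem_image, Prod.exists, Prod.mk.injEq]
  constructor
  · rintro (((h | ⟨a, b, h, rfl, rfl⟩) | ⟨a, b, h, rfl, rfl⟩) | ⟨a, b, h, rfl, rfl⟩) <;> simp [h]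
  · rintro (h | h | h | h)
    · simp [h]
    · exact Or.inl (Or.inl (Or.inr ⟨_, _, h, by ring, rfl⟩))
    · exact Or.inl (Or.inr ⟨_, _, h, rfl, by ring⟩)
    · exact Or.inr ⟨_, _, h, by ring, by ring⟩

variable {S}

/-- Extension by zero of a function on a finite set of grid points. -/
def ext0 {T : Finset Cell} (f : T → ℤ) (v : Cell) : ℤ := if h : v ∈ T then f ⟨v, h⟩ else 0

lemma ext0_mem {T : Finset Cell} (f : T → ℤ) (v : Cell) (h : v ∈ T) : ext0 f v = f ⟨v, h⟩ := by
  simp [ext0, h]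

lemma ext0_restrict {T : Finset Cell} (f : Cell → ℤ) (v : Cell) (h : v ∈ T) :
    ext0 (fun w : T => f w.1) v = f v := by
  simp [ext0, h]

lemma ext0_add {T : Finset Cell} (f g : T → ℤ) (v : Cell) :
    ext0 (f + g) v = ext0 f v + ext0 g v := by
  unfold ext0; split_ifs <;> simp

lemma ext0_smul {T : Finset Cell} (c : ℤ) (f : T → ℤ) (v : Cell) :
    ext0 (c • f) v = c * ext0 f v := by
  unfold ext0; split_ifs <;> simp

variable (S)

/-- The first coboundary map. -/
def d0 : (verts S → ℤ) →ₗ[ℤ] (hEdges S → ℤ) × (vEdges S → ℤ) where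
  toFun f := (fun e => ext0 f (e.1.1 + 1, e.1.2) - ext0 f (e.1.1, e.1.2),
    fun e => ext0 f (e.1.1, e.1.2 + 1) - ext0 f (e.1.1, e.1.2))
  map_add' f g := by
    ext e <;> simp [ext0_add] <;> ring
  map_smul' c f := by
    refine Prod.ext (funext fun e => ?_) (funext fun e => ?_)
    · change ext0 (c • f) _ - ext0 (c • f) _ = c * (_ - _)
      rw [ext0_smul, ext0_smul]; ring
    · change ext0 (c • f) _ - ext0 (c • f) _ = c * (_ - _)
      rw [ext0_smul, ext0_smul]; ring

/-- The second coboundary map. -/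
def d1 : (hEdges S → ℤ) × (vEdges S → ℤ) →ₗ[ℤ] (S → ℤ) where
  toFun f := fun e => ext0 f.1 (e.1.1, e.1.2) + ext0 f.2 (e.1.1 + 1, e.1.2)
    - ext0 f.2 (e.1.1, e.1.2) - ext0 f.1 (e.1.1, e.1.2 + 1)
  map_add' f g := by
    ext e; simp [ext0_add]; ring
  map_smul' c f := by
    refine funext fun e => ?_
    change ext0 (c • f.1) _ + ext0 (c • f.2) _ - ext0 (c • f.2) _ - ext0 (c • f.1) _ =
      c * (_ + _ - _ - _)
    simp only [ext0_smul]; ring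

lemma d1_surj : Function.Surjective (d1 S) := by
  intro g
  -- a potential obtained by summing along columns
  obtain ⟨m, hm⟩ : ∃ m : ℤ, ∀ p ∈ S, m ≤ p.2 := by
    obtain ⟨m, hm⟩ := (S.image Prod.snd).bddBelow
    exact ⟨m, fun p hp => hm (by simpa using ⟨p.1, hp⟩)⟩
  let A : Cell → ℤ := fun v => -∑ j ∈ Finset.Ico m v.2, ext0 g (v.1, j)
  refine ⟨(fun e => A e.1, fun _ => 0), ?_⟩
  ext ⟨⟨x, y⟩, hp⟩
  have h1 : (x, y) ∈ hEdges S := (mem_hEdges S x y).mpr (Or.inl hp)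
  have h2 : (x, y + 1) ∈ hEdges S := (mem_hEdges S x (y + 1)).mpr (Or.inr (by simpa using hp))
  have hz : ∀ v, ext0 (fun _ : vEdges S => (0 : ℤ)) v = 0 := by
    intro v; unfold ext0; split_ifs <;> rfl
  simp only [d1, LinearMap.coe_mk, AddHom.coe_mk, hz, ext0_restrict A _ h1, ext0_restrict A _ h2]
  simp only [A]
  have hy : m ≤ y := hm _ hp
  rw [← Finset.insert_Ico_right_eq_Ico_add_one hy, Finset.sum_insert (by simp),
    ext0_mem g (x, y) hp]
  ring

variable {S}

lemma ker_d1_eq (h : Region S ≃ₜ (Metric.closedBall (0 : EuclideanSpace ℝ (Fin 2)) 1)) :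
    LinearMap.ker (d1 S) = LinearMap.range (d0 S) := by
  ext ⟨a, b⟩
  rw [LinearMap.mem_ker, LinearMap.mem_range]
  constructor
  · intro hk
    have hk' := fun e => congr_fun hk e
    obtain ⟨f, hf⟩ := exact_of_closed h (ext0 a) (ext0 b) (by
      intro x y hp
      have := hk' ⟨(x, y), hp⟩
      simp only [d1, LinearMap.coe_mk, AddHom.coe_mk, Pi.zero_apply] at this
      linarith)
    refine ⟨fun v => f v.1, ?_⟩
    refine Prod.ext ?_ ?_
    · ext ⟨⟨x, y⟩, he⟩
      simp only [d0, LinearMap.coe_mk, AddHom.coe_mk]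
      have he' := (mem_hEdges S x y).mp he
      rw [ext0_restrict f _ ((mem_verts S _ _).mpr (by simp; tauto)),
        ext0_restrict f _ ((mem_verts S _ _).mpr (by tauto)), ← ext0_mem a _ he]
      rcases he' with he' | he'
      · exact (hf _ _ he').1
      · simpa using (hf _ _ he').2.2.1
    · ext ⟨⟨x, y⟩, he⟩
      simp only [d0, LinearMap.coe_mk, AddHom.coe_mk]
      have he' := (mem_vEdges S x y).mp he
      rw [ext0_restrict f _ ((mem_verts S _ _).mpr (by simp; tauto)),
        ext0_restrict f _ ((mem_verts S _ _).mpr (by tauto)), ← ext0_mem b _ he]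
      rcases he' with he' | he'
      · exact (hf _ _ he').2.1
      · simpa using (hf _ _ he').2.2.2
  · rintro ⟨f, hf⟩
    obtain ⟨rfl, rfl⟩ := Prod.ext_iff.mp hf
    ext ⟨⟨x, y⟩, hp⟩
    have h1 := (mem_hEdges S x y).mpr (Or.inl hp)
    have h2 := (mem_hEdges S x (y + 1)).mpr (Or.inr (by simpa using hp))
    have h3 := (mem_vEdges S x y).mpr (Or.inl hp)
    have h4 := (mem_vEdges S (x + 1) y).mpr (Or.inr (by simpa using hp))
    simp only [d1, d0, LinearMap.coe_mk, AddHom.coe_mk, Pi.zero_apply]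
    rw [ext0_mem _ _ h1, ext0_mem _ _ h2, ext0_mem _ _ h3, ext0_mem _ _ h4]
    simp only
    ring

lemma finrank_ker_d0 (hne : S.Nonempty)
    (h : Region S ≃ₜ (Metric.closedBall (0 : EuclideanSpace ℝ (Fin 2)) 1)) :
    Module.finrank ℤ (LinearMap.ker (d0 S)) = 1 := by
  have hker : LinearMap.ker (d0 S) = Submodule.span ℤ {fun _ => (1 : ℤ)} := by
    ext f
    rw [LinearMap.mem_ker, Submodule.mem_span_singleton]
    constructor
    · intro hk
      have e1 : ∀ x y, (x, y) ∈ hEdges S → ext0 f (x + 1, y) = ext0 f (x, y) := by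
        intro x y he
        have := congr_fun (congrArg Prod.fst hk) ⟨(x, y), he⟩
        simp only [d0, LinearMap.coe_mk, AddHom.coe_mk, Prod.fst_zero, Pi.zero_apply] at this
        linarith
      have e2 : ∀ x y, (x, y) ∈ vEdges S → ext0 f (x, y + 1) = ext0 f (x, y) := by
        intro x y he
        have := congr_fun (congrArg Prod.snd hk) ⟨(x, y), he⟩
        simp only [d0, LinearMap.coe_mk, AddHom.coe_mk, Prod.snd_zero, Pi.zero_apply] at this
        linarith
      have hcell : ∀ x y : ℤ, (x, y) ∈ S → ext0 f (x + 1, y) = ext0 f (x, y) ∧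
          ext0 f (x, y + 1) = ext0 f (x, y) ∧ ext0 f (x + 1, y + 1) = ext0 f (x, y) := by
        intro x y hp
        have h1 := e1 x y ((mem_hEdges S x y).mpr (Or.inl hp))
        have h2 := e1 x (y + 1) ((mem_hEdges S x (y + 1)).mpr (Or.inr (by simpa using hp)))
        have h3 := e2 x y ((mem_vEdges S x y).mpr (Or.inl hp))
        exact ⟨h1, h3, h2.trans h3⟩
      obtain ⟨p0, hp0⟩ := hne
      refine ⟨ext0 f p0, ?_⟩
      ext ⟨⟨x, y⟩, hv⟩
      rw [← ext0_mem f _ hv]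
      simp only [Pi.smul_apply, smul_eq_mul, mul_one]
      have hc := fun q hq => const_of_cell (region_preconn h) (ext0 f) hcell p0 q hp0 hq
      rcases (mem_verts S x y).mp hv with hq | hq | hq | hq
      · exact hc _ hq
      · rw [hc _ hq]; simpa using (hcell _ _ hq).1.symm
      · rw [hc _ hq]; simpa using (hcell _ _ hq).2.1.symm
      · rw [hc _ hq]; simpa using (hcell _ _ hq).2.2.symm
    · rintro ⟨c, rfl⟩
      rw [map_smul]
      have : d0 S (fun _ => (1 : ℤ)) = 0 := by
        refine Prod.ext ?_ ?_
        · ext ⟨⟨x, y⟩, he⟩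
          simp only [d0, LinearMap.coe_mk, AddHom.coe_mk]
          have he' := (mem_hEdges S x y).mp he
          rw [ext0_mem _ _ ((mem_verts S _ _).mpr (by simp; tauto)),
            ext0_mem _ _ ((mem_verts S _ _).mpr (by tauto))]
          simp
        · ext ⟨⟨x, y⟩, he⟩
          simp only [d0, LinearMap.coe_mk, AddHom.coe_mk]
          have he' := (mem_vEdges S x y).mp he
          rw [ext0_mem _ _ ((mem_verts S _ _).mpr (by simp; tauto)),
            ext0_mem _ _ ((mem_verts S _ _).mpr (by tauto))]
          simp
      rw [this, smul_zero]
  rw [hker]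
  obtain ⟨⟨x, y⟩, hp⟩ := hne
  have hv : (x, y) ∈ verts S := (mem_verts S x y).mpr (Or.inl hp)
  have hne0 : (fun _ : verts S => (1 : ℤ)) ≠ 0 := by
    intro h0
    exact one_ne_zero (congr_fun h0 ⟨(x, y), hv⟩)
  rw [← (LinearEquiv.toSpanNonzeroSingleton ℤ _ _ hne0).finrank_eq, Module.finrank_self]

lemma rank_nullity {M N : Type} [AddCommGroup M] [AddCommGroup N]
    [Module.Finite ℤ M] (f : M →ₗ[ℤ] N) :
    Module.finrank ℤ (LinearMap.range f) + Module.finrank ℤ (LinearMap.ker f) =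
      Module.finrank ℤ M := by
  rw [← f.quotKerEquivRange.finrank_eq]
  exact Submodule.finrank_quotient_add_finrank _

/-- Euler's formula for boards. -/
lemma euler (hne : S.Nonempty)
    (h : Region S ≃ₜ (Metric.closedBall (0 : EuclideanSpace ℝ (Fin 2)) 1)) :
    (verts S).card + S.card = (hEdges S).card + (vEdges S).card + 1 := by
  have r0 := rank_nullity (d0 S)
  have r1 := rank_nullity (d1 S)
  rw [ker_d1_eq h, LinearMap.range_eq_top.mpr (d1_surj S), finrank_top] at r1
  rw [finrank_ker_d0 hne h] at r0
  simp only [Module.finrank_prod, Module.finrank_fintype_fun_eq_card, Fintype.card_coe] at r0 r1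
  omega

end Euler

lemma sum_ind (T U : Finset Cell) (g : Cell → Cell) (hg : Function.Injective g)
    (hU : ∀ u ∈ U, ∃ v ∈ T, g v = u) :
    ∑ v ∈ T, (if g v ∈ U then (1 : ℤ) else 0) = U.card := by
  rw [Finset.sum_ite, Finset.sum_const_zero, add_zero, Finset.sum_const, nsmul_eq_mul, mul_one]
  congr 1
  rw [← Finset.card_image_of_injective _ hg]
  congr 1
  ext u
  simp only [Finset.mem_image, Finset.mem_filter]
  constructor
  · rintro ⟨v, ⟨-, hv⟩, rfl⟩
    exact hv
  · intro hu
    obtain ⟨v, hv, rfl⟩ := hU u hu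
    exact ⟨v, ⟨hv, hu⟩, rfl⟩

lemma sum_shift {S : Finset Cell} (U : Finset Cell) (i j : ℤ)
    (hU : ∀ x y : ℤ, (x, y) ∈ U → (x + i, y + j) ∈ verts S) :
    ∑ v ∈ verts S, (if (v.1 - i, v.2 - j) ∈ U then (1 : ℤ) else 0) = U.card := by
  apply sum_ind (verts S) U (fun v => (v.1 - i, v.2 - j))
  · rintro ⟨a, b⟩ ⟨c, d⟩ h
    simpa using h
  · rintro ⟨x, y⟩ hu
    exact ⟨_, hU x y hu, by simp⟩

/-- **Lemma.** For a board with `F` cells, `V_I` interior vertices and `V_B`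
boundary vertices, `2 F = 2 V_I + V_B - 2`. -/
theorem two_mul_faces_eq
    (S : Finset Cell) (hS : IsBoard S) :
    (2 * S.card : ℤ) =
      2 * {v : Cell | IsInteriorVertex S v}.ncard
        + {v : Cell | IsBoundaryVertex S v}.ncard - 2 := by

  obtain ⟨hne, ⟨h⟩⟩ := hS
  have hE := euler hne h
  -- vertices, split into interior and boundary ones
  have hI : {v : Cell | IsInteriorVertex S v} = ((verts S).filter fun v =>
      (v.1, v.2) ∈ S ∧ (v.1 - 1, v.2) ∈ S ∧ (v.1, v.2 - 1) ∈ S ∧ (v.1 - 1, v.2 - 1) ∈ S) := by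
    ext v
    simp only [Set.mem_ofPred_eq, IsInteriorVertex, Finset.coe_filter, mem_verts S v.1 v.2]
    rw [isVertex_iff, ← mem_verts S v.1 v.2]
    refine and_congr_right fun hv => ?_
    exact not_frontier_iff S v ((isVertex_iff S v).mpr ((mem_verts S v.1 v.2).mp hv))
  have hB : {v : Cell | IsBoundaryVertex S v} = ((verts S).filter fun v =>
      ¬ ((v.1, v.2) ∈ S ∧ (v.1 - 1, v.2) ∈ S ∧ (v.1, v.2 - 1) ∈ S ∧
        (v.1 - 1, v.2 - 1) ∈ S)) := by
    ext v
    simp only [Set.mem_ofPred_eq, IsBoundaryVertex, Finset.coe_filter]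
    rw [isVertex_iff, ← mem_verts S v.1 v.2]
    refine and_congr_right fun hv => ?_
    rw [← not_frontier_iff S v ((isVertex_iff S v).mpr ((mem_verts S v.1 v.2).mp hv)), not_not]
  rw [hI, hB, Set.ncard_coe_finset, Set.ncard_coe_finset]
  have hsplit := Finset.card_filter_add_card_filter_not (s := verts S) (fun v =>
      (v.1, v.2) ∈ S ∧ (v.1 - 1, v.2) ∈ S ∧ (v.1, v.2 - 1) ∈ S ∧ (v.1 - 1, v.2 - 1) ∈ S)
  -- double counting of the incidences at the vertices
  have hloc : ∀ v ∈ verts S,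
      ((if (v.1 - 0, v.2 - 0) ∈ hEdges S then (1 : ℤ) else 0) +
       (if (v.1 - 1, v.2 - 0) ∈ hEdges S then (1 : ℤ) else 0)) +
      ((if (v.1 - 0, v.2 - 0) ∈ vEdges S then (1 : ℤ) else 0) +
       (if (v.1 - 0, v.2 - 1) ∈ vEdges S then (1 : ℤ) else 0)) =
      ((if (v.1 - 0, v.2 - 0) ∈ S then (1 : ℤ) else 0) +
       (if (v.1 - 1, v.2 - 0) ∈ S then (1 : ℤ) else 0) +
       (if (v.1 - 0, v.2 - 1) ∈ S then (1 : ℤ) else 0) +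
       (if (v.1 - 1, v.2 - 1) ∈ S then (1 : ℤ) else 0)) +
      (if ¬ ((v.1, v.2) ∈ S ∧ (v.1 - 1, v.2) ∈ S ∧ (v.1, v.2 - 1) ∈ S ∧
        (v.1 - 1, v.2 - 1) ∈ S) then (1 : ℤ) else 0) := by
    rintro ⟨x, y⟩ hv
    rw [mem_verts] at hv
    have n1 := no_pinch1 h x y
    have n2 := no_pinch2 h x y
    simp only [mem_hEdges, mem_vEdges, sub_zero]
    by_cases c1 : (x, y) ∈ S <;> by_cases c2 : (x - 1, y) ∈ S <;>
      by_cases c3 : (x, y - 1) ∈ S <;> by_cases c4 : (x - 1, y - 1) ∈ S <;>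
      simp_all
  have hsum := Finset.sum_congr rfl hloc
  simp only [Finset.sum_add_distrib] at hsum
  rw [sum_shift (hEdges S) 0 0, sum_shift (hEdges S) 1 0, sum_shift (vEdges S) 0 0,
    sum_shift (vEdges S) 0 1, sum_shift S 0 0, sum_shift S 1 0, sum_shift S 0 1,
    sum_shift S 1 1, Finset.sum_boole] at hsum
  · zify at hE hsplit
    linarith
  all_goals
    intro x y hxy
    try simp only [mem_hEdges, mem_vEdges] at hxy
    rw [mem_verts]
    simp
    tauto
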